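/- Let (X, ‖·‖_X) be a Banach space continuously embedded in a Banach space (W, ‖·‖_W). Let V, Z and M be closed subsets of X such that: V and Z are linear subspaces of X with V + Z = X and codim Z < dim V < +∞; M = ∂N where N ⊂ X is a neighborhood of the origin which is symmetric and bounded with respect to ‖·‖_W. Fix R > 0 and define Γ_R = {γ : X → X : γ is an odd homeomorphism and γ(u) = u for all u ∈ V with ‖u‖_X ≥ R}. Then γ(V) ∩ M ∩ Z ≠ ∅ for every γ ∈ Γ_R. -/

import Mathlib

open Filter Topology

variable {X W : Type*} [NormedAddCommGroup X] [NormedSpace ℝ X]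
  [NormedAddCommGroup W] [NormedSpace ℝ W]

/-- A Cerami–Palais–Smale sequence for `J` at level `β`. -/
def IsCPSSeq (J : X → ℝ) (J' : X → X →L[ℝ] ℝ) (β : ℝ) (u : ℕ → X) : Prop :=
  Tendsto (fun n => J (u n)) atTop (𝓝 β) ∧
    Tendsto (fun n => ‖J' (u n)‖ * (1 + ‖u n‖)) atTop (𝓝 0)

/-- The weak Cerami–Palais–Smale condition at level `β`, with respect to the
continuous embedding `ι : X → W`. -/
def WCPS (ι : X →L[ℝ] W) (J : X → ℝ) (J' : X → X →L[ℝ] ℝ) (β : ℝ) : Prop :=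
  ∀ u : ℕ → X, IsCPSSeq J J' β u →
    ∃ v : X, (∃ φ : ℕ → ℕ, StrictMono φ ∧
        Tendsto (fun n => ‖ι (u (φ n)) - ι v‖) atTop (𝓝 0)) ∧ J v = β ∧ J' v = 0

/-- `0` is a convex combination of the vectors `a k` with `k ≠ r`. -/
def ZeroOnFacet {n m : ℕ} (a : Fin n → Fin m → ℝ) (r : Fin n) : Prop :=
  ∃ c : Fin n → ℝ, (∀ k, 0 ≤ c k) ∧ c r = 0 ∧ ∑ k, c k = 1 ∧ ∑ k, c k • a k = 0

/-- A linear relation between the vectors `a k` with two vanishing coefficients is trivial. -/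
def GeneralPosition {n m : ℕ} (a : Fin n → Fin m → ℝ) : Prop :=
  ∀ c : Fin n → ℝ, ∑ k, c k • a k = 0 → ∀ i j, i ≠ j → c i = 0 → c j = 0 → c = 0

lemma GeneralPosition.proportional {n m : ℕ} {a : Fin n → Fin m → ℝ} (ha : GeneralPosition a)
    {b c : Fin n → ℝ} (hb : ∑ k, b k • a k = 0) (hc : ∑ k, c k • a k = 0) {i j : Fin n}
    (hij : i ≠ j) (hbi : b i = 0) (hci : c i = 0) (k : Fin n) : c j * b k = b j * c k := by
  have h := ha (fun k => c j * b k - b j * c k) ?_ i j hij (by simp [hbi, hci]) (by ring)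
  · have := congrFun h k
    simp only [Pi.zero_apply] at this
    linarith
  · simp only [sub_smul, mul_smul, Finset.sum_sub_distrib, ← Finset.smul_sum, hb, hc, smul_zero,
      sub_zero]

/-- In general position, the facets of a simplex of dimension `m + 1` whose image in `ℝ^m`
contains the origin come in pairs. -/
lemma GeneralPosition.existsUnique {m : ℕ} {a : Fin (m + 2) → Fin m → ℝ}
    (ha : GeneralPosition a) {i : Fin (m + 2)} (hi : ZeroOnFacet a i) :
    ∃! j, j ≠ i ∧ ZeroOnFacet a j := by
  have hpos : ∀ c : Fin (m + 2) → ℝ, (∀ k, 0 ≤ c k) → ∑ k, c k = 1 → ∑ k, c k • a k = 0 →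
      ∀ i k, c i = 0 → k ≠ i → 0 < c k := by
    intro c h0 h1 h2 i k hci hki
    refine lt_of_le_of_ne (h0 k) fun h => ?_
    have := ha c h2 k i hki h.symm hci
    simp [this] at h1
  obtain ⟨c, c0, ci, c1, ca⟩ := hi
  obtain ⟨b, hb, hbi⟩ : ∃ b : Fin (m + 2) → ℝ, ∑ k, b k • a k = 0 ∧ b i = 1 := by
    obtain ⟨i', hi'⟩ := exists_ne i
    let L : (Fin (m + 2) → ℝ) →ₗ[ℝ] (Fin m → ℝ) × ℝ :=
      (Fintype.linearCombination ℝ a).prod (LinearMap.proj i')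
    have hL : ∃ b, b ≠ 0 ∧ L b = 0 := by
      by_contra! h
      have hinj : Function.Injective L := by
        rw [← LinearMap.ker_eq_bot, LinearMap.ker_eq_bot']
        intro b hb
        by_contra hne
        exact h b hne hb
      have := LinearMap.finrank_le_finrank_of_injective hinj
      simp at this
    obtain ⟨b, hb0, hb⟩ := hL
    have hb1 : ∑ k, b k • a k = 0 := by
      have := congrArg Prod.fst hb
      simpa [L, Fintype.linearCombination_apply] using this
    have hb2 : b i' = 0 := by
      have := congrArg Prod.snd hb
      simpa [L] using this
    have hbi : b i ≠ 0 := fun h => hb0 (ha b hb1 i' i hi' hb2 h)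
    refine ⟨fun k => (b i)⁻¹ * b k, ?_, by field_simp⟩
    simp only [mul_smul, ← Finset.smul_sum, hb1, smul_zero]
  have cpos : ∀ k, k ≠ i → 0 < c k := fun k hk => hpos c c0 c1 ca i k ci hk
  have hne : (Finset.univ.erase i).Nonempty := by
    obtain ⟨i', hi'⟩ := exists_ne i
    exact ⟨i', by simp [hi']⟩
  obtain ⟨j, hj, hmax⟩ := Finset.exists_max_image _ (fun k => -b k / c k) hne
  have hji : j ≠ i := by simpa using hj
  have hjz : ZeroOnFacet a j := by
    set t := -b j / c j with ht
    let d : Fin (m + 2) → ℝ := fun k => b k + t * c k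
    have d0 : ∀ k, 0 ≤ d k := by
      intro k
      by_cases hk : k = i
      · simp [d, hk, hbi, ci]
      · have h1 := hmax k (by simp [hk])
        have h2 := cpos k hk
        have h3 := (div_le_iff₀ h2).1 h1
        simp only [d]
        linarith
    have di : d i = 1 := by simp [d, hbi, ci]
    have hs : 0 < ∑ k, d k :=
      Finset.sum_pos' (fun k _ => d0 k) ⟨i, Finset.mem_univ _, by simp [di]⟩
    refine ⟨fun k => (∑ k, d k)⁻¹ * d k, fun k => mul_nonneg (by positivity) (d0 k), ?_, ?_, ?_⟩
    · have := (cpos j hji).ne'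
      have : d j = 0 := by
        simp only [d, ht]
        field_simp
        ring
      simp [this]
    · rw [← Finset.mul_sum, inv_mul_cancel₀ hs.ne']
    · simp only [mul_smul, ← Finset.smul_sum, d, add_smul, Finset.sum_add_distrib, hb, ca,
        smul_zero, add_zero]
  refine ⟨j, ⟨hji, hjz⟩, ?_⟩
  rintro l ⟨hli, g, g0, gl, g1, ga⟩
  obtain ⟨f, f0, fj, f1, fa⟩ := hjz
  by_contra hlj
  have gi := hpos g g0 g1 ga l i gl (Ne.symm hli)
  have fi := hpos f f0 f1 fa j i fj (Ne.symm hji)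
  have gj := hpos g g0 g1 ga l j gl (Ne.symm hlj)
  have fl := hpos f f0 f1 fa j l fj hlj
  have h := ha.proportional (b := fun k => g i * f k - f i * g k) (c := c) (i := i) (j := j)
    (by simp only [sub_smul, mul_smul, Finset.sum_sub_distrib, ← Finset.smul_sum, ga, fa,
      smul_zero, sub_zero]) ca hji.symm (by ring) ci l
  simp only [fj, gl, mul_zero, sub_zero, zero_sub] at h
  nlinarith [mul_pos (cpos j hji) (mul_pos gi fl), mul_pos (cpos l hli) (mul_pos fi gj)]

lemma four_dvd_card_of_involutions {α : Type*} (s : Finset α) (f g : α → α)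
    (hf : ∀ p ∈ s, f p ∈ s) (hg : ∀ p ∈ s, g p ∈ s) (hff : ∀ p ∈ s, f (f p) = p)
    (hgg : ∀ p ∈ s, g (g p) = p) (hfg : ∀ p ∈ s, f (g p) = g (f p)) (hf' : ∀ p ∈ s, f p ≠ p)
    (hg' : ∀ p ∈ s, g p ≠ p) (hfg' : ∀ p ∈ s, f (g p) ≠ p) : 4 ∣ s.card := by
  classical
  let o : α → Finset α := fun p => {p, f p, g p, f (g p)}
  rw [Finset.card_eq_sum_card_image o s]
  refine Finset.dvd_sum fun b hb => ?_
  obtain ⟨p, hp, rfl⟩ := Finset.mem_image.1 hb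
  have h1 := hff p hp
  have h2 := hgg p hp
  have h3 := hfg p hp
  have h4 := hff _ (hg p hp)
  have h5 := hgg _ (hf p hp)
  have h6 := hfg _ (hf p hp)
  have h7 := hfg _ (hg p hp)
  have e : s.filter (fun q => o q = o p) = o p := by
    ext q
    simp only [Finset.mem_filter]
    constructor
    · rintro ⟨-, h⟩
      rw [← h]
      simp [o]
    · intro h
      simp only [o, Finset.mem_insert, Finset.mem_singleton] at h
      rcases h with rfl | rfl | rfl | rfl
      · exact ⟨hp, rfl⟩
      · refine ⟨hf p hp, ?_⟩
        ext x
        simp only [o, Finset.mem_insert, Finset.mem_singleton]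
        grind
      · refine ⟨hg p hp, ?_⟩
        ext x
        simp only [o, Finset.mem_insert, Finset.mem_singleton]
        grind
      · refine ⟨hf _ (hg p hp), ?_⟩
        ext x
        simp only [o, Finset.mem_insert, Finset.mem_singleton]
        grind
  rw [e]
  have : (o p).card = 4 := by
    have a1 := hf' p hp
    have a2 := hg' p hp
    have a3 := hfg' p hp
    have a4 := hf' _ (hg p hp)
    have a5 := hg' _ (hf p hp)
    simp only [o]
    rw [Finset.card_insert_of_notMem, Finset.card_insert_of_notMem, Finset.card_insert_of_notMem,
      Finset.card_singleton]
    · simp; grind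
    · simp; grind
    · simp; grind
  rw [this]

namespace Freudenthal

/-- The `k`-th vertex of the simplex of the Freudenthal triangulation of `ℝ^(m+1)` with first
vertex `p.1` and with steps ordered by `p.2`; the step `0` is `(-1, …, -1)` and the step `j + 1`
is the `j`-th unit vector. -/
def vert {m : ℕ} (p : (Fin (m + 1) → ℤ) × Equiv.Perm (Fin (m + 2))) (k : Fin (m + 2)) :
    Fin (m + 1) → ℤ :=
  fun j => p.1 j + (if p.2 j.succ < k then 1 else 0) - (if p.2 0 < k then 1 else 0)

/-- The simplex sharing with `p` the facet opposite to the first vertex. -/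
def pivot {m : ℕ} (p : (Fin (m + 1) → ℤ) × Equiv.Perm (Fin (m + 2))) :
    (Fin (m + 1) → ℤ) × Equiv.Perm (Fin (m + 2)) :=
  (fun j => p.1 j + (if p.2 j.succ = 0 then 1 else 0) - (if p.2 j.succ = Fin.last _ then 1 else 0)
      - (if p.2 0 = 0 then 1 else 0) + (if p.2 0 = Fin.last _ then 1 else 0),
    p.2.trans (Equiv.swap 0 (Fin.last _)))

/-- The antipodal simplex. -/
def antipode {m : ℕ} (p : (Fin (m + 1) → ℤ) × Equiv.Perm (Fin (m + 2))) :
    (Fin (m + 1) → ℤ) × Equiv.Perm (Fin (m + 2)) :=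
  (-p.1, p.2.trans Fin.revPerm)

/-- The same simplex, with the `r`-th vertex as first vertex. -/
def rotate {m : ℕ} (p : (Fin (m + 1) → ℤ) × Equiv.Perm (Fin (m + 2))) (r : Fin (m + 2)) :
    (Fin (m + 1) → ℤ) × Equiv.Perm (Fin (m + 2)) :=
  (vert p r, p.2.trans (Equiv.subRight r))

variable {m : ℕ} (p : (Fin (m + 1) → ℤ) × Equiv.Perm (Fin (m + 2)))

@[simp] lemma vert_zero : vert p 0 = p.1 := by
  ext j
  simp [vert]

lemma pivot_snd_apply (i : Fin (m + 2)) :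
    (pivot p).2 i = if p.2 i = 0 then Fin.last _ else if p.2 i = Fin.last _ then 0 else p.2 i := by
  simp [pivot, Equiv.swap_apply_def]

lemma vert_pivot {k : Fin (m + 2)} (hk : k ≠ 0) : vert (pivot p) k = vert p k := by
  ext j
  simp only [vert, pivot_snd_apply]
  simp only [pivot]
  generalize p.2 j.succ = a
  generalize p.2 0 = b
  simp only [Fin.ext_iff, Fin.lt_def, Fin.val_last, Fin.val_zero, ne_eq] at *
  split_ifs <;> simp_all <;> omega

lemma pivot_pivot : pivot (pivot p) = p := by
  refine Prod.ext (funext fun j => ?_) (Equiv.ext fun i => ?_)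
  · have h1 := pivot_snd_apply p j.succ
    have h2 := pivot_snd_apply p 0
    have h3 : (pivot (pivot p)).1 j = (pivot p).1 j + (if (pivot p).2 j.succ = 0 then 1 else 0)
      - (if (pivot p).2 j.succ = Fin.last _ then 1 else 0)
      - (if (pivot p).2 0 = 0 then 1 else 0) + (if (pivot p).2 0 = Fin.last _ then 1 else 0) := rfl
    rw [h3]
    simp only [h1, h2]
    simp only [pivot]
    generalize p.2 j.succ = a
    generalize p.2 0 = b
    have hl : Fin.last (m + 1) ≠ 0 := by simp [Fin.ext_iff]
    by_cases ha : a = 0 <;> by_cases ha' : a = Fin.last _ <;> by_cases hb : b = 0 <;>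
      by_cases hb' : b = Fin.last _ <;> simp [ha, ha', hb, hb', hl, hl.symm]
  · simp [pivot]

lemma pivot_fst_ne : (pivot p).1 ≠ p.1 := by
  intro h
  have h1 : ∀ j : Fin (m + 1), (if p.2 j.succ = 0 then 1 else 0)
      - (if p.2 j.succ = Fin.last _ then 1 else 0)
      - (if p.2 0 = 0 then 1 else 0) + (if p.2 0 = Fin.last _ then 1 else 0) = (0 : ℤ) := by
    intro j
    have := congrFun h j
    simp only [pivot] at this
    linarith
  have h2 : ∀ i, (if p.2 i = 0 then 1 else 0) - (if p.2 i = Fin.last _ then 1 else 0)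
      = (if p.2 0 = 0 then 1 else 0) - (if p.2 0 = Fin.last _ then (1 : ℤ) else 0) := by
    intro i
    refine Fin.cases rfl (fun j => ?_) i
    linarith [h1 j]
  have h3 := h2 (p.2.symm 0)
  have h4 := h2 (p.2.symm (Fin.last _))
  rw [← h4] at h3
  simp at h3

lemma antipode_antipode : antipode (antipode p) = p := by
  refine Prod.ext (funext fun j => ?_) (Equiv.ext fun i => ?_)
  · simp [antipode]
  · simp [antipode]

lemma vert_antipode (k : Fin (m + 2)) : vert (antipode p) k = -vert p (-k) := by
  ext j
  simp only [vert, antipode, Pi.neg_apply, Equiv.trans_apply, Fin.revPerm_apply]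
  generalize p.2 j.succ = a
  generalize p.2 0 = b
  simp only [Fin.lt_def, Fin.val_rev, Fin.val_neg]
  by_cases hk : k = 0
  · simp [hk]
  · have : (k : ℕ) ≠ 0 := fun h => hk (Fin.ext h)
    have h3 := k.isLt
    have h4 := a.isLt
    have h5 := b.isLt
    rw [if_neg hk]
    split_ifs <;> omega

lemma antipode_pivot : antipode (pivot p) = pivot (antipode p) := by
  refine Prod.ext (funext fun j => ?_) (Equiv.ext fun i => ?_)
  · have h1 : ∀ i, (antipode p).2 i = Fin.rev (p.2 i) := fun i => by simp [antipode]
    simp only [pivot, h1]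
    simp only [antipode, Pi.neg_apply]
    generalize p.2 j.succ = a
    generalize p.2 0 = b
    simp only [Fin.ext_iff, Fin.val_rev, Fin.val_last, Fin.val_zero]
    have h4 := a.isLt
    have h5 := b.isLt
    split_ifs <;> omega
  · rw [pivot_snd_apply]
    have h1 : ∀ q : (Fin (m + 1) → ℤ) × Equiv.Perm (Fin (m + 2)), ∀ i,
      (antipode q).2 i = Fin.rev (q.2 i) := fun q i => by simp [antipode]
    simp only [h1, pivot_snd_apply]
    generalize p.2 i = a
    have h4 := a.isLt
    simp only [apply_ite Fin.val, apply_ite Fin.rev, Fin.ext_iff, Fin.val_rev, Fin.val_last,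
      Fin.val_zero]
    split_ifs <;> omega

lemma vert_rotate (r k : Fin (m + 2)) : vert (rotate p r) k = vert p (k + r) := by
  ext j
  simp only [rotate, vert, Equiv.trans_apply, Equiv.subRight_apply]
  generalize p.2 j.succ = a
  generalize p.2 0 = b
  simp only [Fin.lt_def, Fin.val_add_eq_ite, Fin.val_sub]
  have h3 := k.isLt
  have h4 := a.isLt
  have h5 := b.isLt
  have h6 := r.isLt
  have key : ∀ u : ℕ, u < m + 2 → (m + 2 - r + u) % (m + 2) =
      if u < r then m + 2 - r + u else u - r := by
    intro u hu
    split_ifs with h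
    · exact Nat.mod_eq_of_lt (by omega)
    · rw [show m + 2 - r + u = (u - r) + (m + 2) by omega, Nat.add_mod_right]
      exact Nat.mod_eq_of_lt (by omega)
  rw [key a h4, key b h5]
  split_ifs <;> omega

lemma rotate_rotate (r s : Fin (m + 2)) : rotate (rotate p r) s = rotate p (s + r) := by
  refine Prod.ext (funext fun j => ?_) (Equiv.ext fun i => ?_)
  · exact congrFun (vert_rotate p r s) j
  · simp only [rotate, Equiv.trans_apply, Equiv.subRight_apply]
    abel

@[simp] lemma rotate_zero : rotate p 0 = p := by
  refine Prod.ext (funext fun j => ?_) (Equiv.ext fun i => ?_)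
  · simp [rotate]
  · simp [rotate]

lemma antipode_rotate (r : Fin (m + 2)) :
    antipode (rotate p r) = rotate (antipode p) (-r) := by
  refine Prod.ext (funext fun j => ?_) (Equiv.ext fun i => ?_)
  · have := vert_antipode p (-r)
    simp only [neg_neg] at this
    simp [antipode, rotate]
    simpa [antipode] using (congrFun this j).symm
  · simp only [rotate, antipode, Equiv.trans_apply, Equiv.subRight_apply, Fin.revPerm_apply]
    have : ∀ u : Fin (m + 2), Fin.rev u = -1 - u := by
      intro u
      rw [← Fin.last_sub, show Fin.last (m + 1) = -1 from Fin.ext (by simp)]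
    rw [this, this]
    abel

lemma vert_injective : Function.Injective (vert p) := by
  intro k l h
  by_contra hkl
  wlog hlt : k < l generalizing k l
  · exact this h.symm (Ne.symm hkl) (lt_of_le_of_ne (not_lt.1 hlt) (Ne.symm hkl))
  have h1 : ∀ i, (if p.2 i < k then 1 else 0) - (if p.2 i < l then 1 else 0) =
      (if p.2 0 < k then (1 : ℤ) else 0) - (if p.2 0 < l then 1 else 0) := by
    intro i
    refine Fin.cases rfl (fun j => ?_) i
    have := congrFun h j
    simp only [vert] at this
    linarith
  have h2 := h1 (p.2.symm k)
  have h3 := h1 (p.2.symm (Fin.last _))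
  rw [← h3] at h2
  simp [hlt, not_lt.2 (Fin.le_last _)] at h2

lemma vert_eq_zero_of_eq_neg {k l : Fin (m + 2)} (h : vert p k = -vert p l) : vert p k = 0 := by
  ext j
  have := congrFun h j
  simp only [vert, Pi.neg_apply, Pi.zero_apply] at *
  split_ifs at * <;> omega

lemma abs_vert_sub_le (k l : Fin (m + 2)) (j : Fin (m + 1)) : |vert p k j - vert p l j| ≤ 2 := by
  simp only [vert, abs_le]
  split_ifs <;> omega

end Freudenthal

lemma ZeroOnFacet.comp_equiv {n n' m : ℕ} {a : Fin n → Fin m → ℝ} (e : Fin n' ≃ Fin n)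
    {s : Fin n'} (h : ZeroOnFacet a (e s)) : ZeroOnFacet (fun k => a (e k)) s := by
  obtain ⟨c, c0, cs, c1, ca⟩ := h
  exact ⟨fun k => c (e k), fun k => c0 _, cs, by rw [e.sum_comp c, c1],
    by rw [e.sum_comp (fun k => c k • a k), ca]⟩

lemma ZeroOnFacet.neg {n m : ℕ} {a : Fin n → Fin m → ℝ} {s : Fin n} (h : ZeroOnFacet a s) :
    ZeroOnFacet (fun k => -a k) s := by
  obtain ⟨c, c0, cs, c1, ca⟩ := h
  exact ⟨c, c0, cs, c1, by simp [ca]⟩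

lemma ZeroOnFacet.congr {n m : ℕ} {a b : Fin n → Fin m → ℝ} {s : Fin n} (h : ZeroOnFacet a s)
    (hab : ∀ k, k ≠ s → a k = b k) : ZeroOnFacet b s := by
  obtain ⟨c, c0, cs, c1, ca⟩ := h
  refine ⟨c, c0, cs, c1, ?_⟩
  rw [← ca]
  refine Finset.sum_congr rfl fun k _ => ?_
  by_cases hk : k = s
  · simp [hk, cs]
  · rw [hab k hk]

lemma Equiv.Perm.eq_one_of_strictMono {n : ℕ} {ρ : Equiv.Perm (Fin n)} (h : StrictMono ρ) :
    ρ = 1 := by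
  have := Subsingleton.elim (h.orderIsoOfSurjective _ ρ.surjective) (OrderIso.refl (Fin n))
  ext i
  exact congrArg (fun f : Fin n ≃o Fin n => (f i : ℕ)) this

/-- A linear map `ℝ^(m+1) → ℝ^m` whose kernel is spanned by `(1, 2, …, m + 1)`. -/
def rampProj (m : ℕ) : (Fin (m + 1) → ℝ) →ₗ[ℝ] (Fin m → ℝ) :=
  LinearMap.pi fun i => LinearMap.proj i.succ - ((i : ℝ) + 2) • LinearMap.proj 0

lemma rampProj_apply {m : ℕ} (y : Fin (m + 1) → ℝ) (i : Fin m) :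
    rampProj m y i = y i.succ - ((i : ℝ) + 2) * y 0 := by
  simp [rampProj]

lemma rampProj_eq_zero_iff {m : ℕ} (y : Fin (m + 1) → ℝ) :
    rampProj m y = 0 ↔ ∃ t : ℝ, ∀ j, y j = ((j : ℝ) + 1) * t := by
  constructor
  · intro h
    refine ⟨y 0, fun j => ?_⟩
    refine Fin.cases (by simp) (fun i => ?_) j
    have := congrFun h i
    rw [rampProj_apply, Pi.zero_apply] at this
    push_cast [Fin.val_succ]
    linarith
  · rintro ⟨t, ht⟩
    ext i
    rw [rampProj_apply, ht, ht]
    push_cast [Fin.val_succ]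
    simp
    ring

namespace Freudenthal

variable {m : ℕ}

lemma zeroOnFacet_pivot {w : (Fin (m + 1) → ℤ) → Fin m → ℝ}
    {p : (Fin (m + 1) → ℤ) × Equiv.Perm (Fin (m + 2))}
    (h : ZeroOnFacet (fun k => w (vert p k)) 0) :
    ZeroOnFacet (fun k => w (vert (pivot p) k)) 0 :=
  h.congr fun k hk => by rw [vert_pivot p hk]

lemma zeroOnFacet_rotate_iff {w : (Fin (m + 1) → ℤ) → Fin m → ℝ}
    {p : (Fin (m + 1) → ℤ) × Equiv.Perm (Fin (m + 2))} {r s : Fin (m + 2)} :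
    ZeroOnFacet (fun k => w (vert (rotate p r) k)) s ↔
      ZeroOnFacet (fun k => w (vert p k)) (s + r) := by
  simp only [vert_rotate]
  constructor
  · intro h
    have h' : ZeroOnFacet (fun k => w (vert p (k + r))) (Equiv.subRight r (s + r)) := by
      simpa using h
    simpa using ZeroOnFacet.comp_equiv (Equiv.subRight r) h'
  · exact fun h => ZeroOnFacet.comp_equiv (a := fun k => w (vert p k)) (Equiv.addRight r) h

lemma zeroOnFacet_antipode {w : (Fin (m + 1) → ℤ) → Fin m → ℝ} (hodd : ∀ x, w (-x) = -w x)
    {p : (Fin (m + 1) → ℤ) × Equiv.Perm (Fin (m + 2))} {r : Fin (m + 2)}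
    (h : ZeroOnFacet (fun k => w (vert p k)) r) :
    ZeroOnFacet (fun k => w (vert (antipode p) k)) (-r) := by
  simp only [vert_antipode, hodd]
  refine ZeroOnFacet.neg ?_
  refine ZeroOnFacet.comp_equiv (a := fun k => w (vert p k)) (Equiv.neg _) ?_
  simpa using h

lemma sum_smul_rampProj_vert (c : Fin (m + 2) → ℝ)
    (p : (Fin (m + 1) → ℤ) × Equiv.Perm (Fin (m + 2))) :
    ∑ k, c k • rampProj m (fun j => (vert p k j : ℝ)) =
      rampProj m (fun j => ∑ k, c k * (vert p k j : ℝ)) := by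
  simp only [← map_smul, ← map_sum]
  congr 1
  ext j
  simp

/-- The linear map `rampProj` has a zero on the outer facet of exactly two simplices of the star
of the origin. -/
lemma zeroOnFacet_star_iff (ρ : Equiv.Perm (Fin (m + 2))) :
    ZeroOnFacet (fun k => rampProj m (fun j => (vert (0, ρ) k j : ℝ))) 0 ↔
      ρ = 1 ∨ ρ = Fin.revPerm := by
  have hrev : antipode ((0, 1) : (Fin (m + 1) → ℤ) × Equiv.Perm (Fin (m + 2))) =
      (0, Fin.revPerm) := by
    refine Prod.ext (by simp [antipode]) (Equiv.ext fun i => ?_)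
    simp [antipode]
  constructor
  · rintro ⟨c, c0, cz, c1, ca⟩
    rw [sum_smul_rampProj_vert, rampProj_eq_zero_iff] at ca
    obtain ⟨t, ht⟩ := ca
    set Y : Fin (m + 2) → ℝ := fun i => ∑ k, if ρ i < k then c k else 0 with hY
    have hYt : ∀ i, Y i = Y 0 + i * t := by
      intro i
      refine Fin.cases (by simp) (fun j => ?_) i
      have h1 := ht j
      have h2 : Y j.succ - Y 0 = ∑ k, c k * (vert (0, ρ) k j : ℝ) := by
        rw [hY, ← Finset.sum_sub_distrib]
        refine Finset.sum_congr rfl fun k _ => ?_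
        simp only [vert]
        split_ifs <;> simp
      push_cast [Fin.val_succ]
      linarith
    have hmono : ∀ i i', ρ i ≤ ρ i' → Y i' ≤ Y i := by
      intro i i' h
      refine Finset.sum_le_sum fun k _ => ?_
      by_cases h1 : ρ i' < k
      · rw [if_pos h1, if_pos (h.trans_lt h1)]
      · rw [if_neg h1]
        split_ifs
        · exact c0 k
        · exact le_rfl
    rcases lt_trichotomy t 0 with h | h | h
    · left
      refine Equiv.Perm.eq_one_of_strictMono fun i i' hi => ?_
      by_contra hcon
      have h1 := hmono _ _ (not_lt.1 hcon)
      rw [hYt i, hYt i'] at h1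
      have h2 : (i : ℝ) < i' := by exact_mod_cast hi
      nlinarith
    · exfalso
      have h1 := hYt (ρ.symm 0)
      rw [h, mul_zero, add_zero] at h1
      have h2 := hYt (ρ.symm (Fin.last _))
      rw [h, mul_zero, add_zero, ← h1] at h2
      have h3 : Y (ρ.symm (Fin.last _)) = 0 := by
        refine Finset.sum_eq_zero fun k _ => ?_
        rw [if_neg]
        simp [Fin.le_last]
      have h4 : Y (ρ.symm 0) = 1 := by
        rw [← c1]
        refine Finset.sum_congr rfl fun k _ => ?_
        by_cases hk : k = 0
        · simp [hk, cz]
        · simp [Fin.pos_iff_ne_zero, hk]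
      linarith
    · right
      have : ρ.trans Fin.revPerm = 1 := by
        refine Equiv.Perm.eq_one_of_strictMono fun i i' hi => ?_
        simp only [Equiv.trans_apply, Fin.revPerm_apply, Fin.rev_lt_rev]
        by_contra hcon
        have h1 := hmono _ _ (not_lt.1 hcon)
        rw [hYt i, hYt i'] at h1
        have h2 : (i : ℝ) < i' := by exact_mod_cast hi
        nlinarith
      ext i
      have h1 := congrArg (fun f : Equiv.Perm (Fin (m + 2)) => Fin.rev (f i)) this
      simp at h1
      simp [h1]
  · have h1 : ZeroOnFacet (fun k => rampProj m
        (fun j => (vert ((0 : Fin (m + 1) → ℤ), (1 : Equiv.Perm (Fin (m + 2)))) k j : ℝ))) 0 := by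
      refine ⟨fun k => if k = 0 then 0 else ((m : ℝ) + 1)⁻¹, fun k => ?_, by simp, ?_, ?_⟩
      · dsimp only
        split_ifs <;> positivity
      · rw [Fin.sum_univ_succ]
        simp [Fin.succ_ne_zero]
        field_simp
      · rw [sum_smul_rampProj_vert, rampProj_eq_zero_iff]
        refine ⟨-((m : ℝ) + 1)⁻¹, fun j => ?_⟩
        have h2 : ∀ i : Fin (m + 2), ∑ k : Fin (m + 2), (if i < k then (1 : ℝ) else 0) =
            (m : ℝ) + 1 - i := by
          intro i
          rw [Finset.sum_boole]
          have : (Finset.univ.filter (fun k => i < k)) = Finset.Ioi i := by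
            ext
            simp
          rw [this, Fin.card_Ioi]
          have := i.isLt
          rw [Nat.cast_sub (by omega), Nat.cast_sub (by omega)]
          push_cast
          ring
        have h3 : ∀ k : Fin (m + 2), (if k = 0 then 0 else ((m : ℝ) + 1)⁻¹) *
            (vert ((0 : Fin (m + 1) → ℤ), (1 : Equiv.Perm (Fin (m + 2)))) k j : ℝ) =
            ((m : ℝ) + 1)⁻¹ * ((if j.succ < k then (1 : ℝ) else 0) - (if 0 < k then 1 else 0)) := by
          intro k
          by_cases hk : k = 0
          · simp [hk]
          · have hk' : 0 < k := Fin.pos_iff_ne_zero.2 hk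
            by_cases hj : j.succ < k <;> simp [vert, hk, hj, hk']
        rw [Finset.sum_congr rfl fun k _ => h3 k, ← Finset.mul_sum, Finset.sum_sub_distrib, h2, h2]
        push_cast [Fin.val_succ, Fin.val_zero]
        ring
    rintro (rfl | rfl)
    · exact h1
    · rw [← hrev]
      have := zeroOnFacet_antipode (w := fun x => rampProj m (fun j => (x j : ℝ)))
        (fun x => by rw [← map_neg]; congr 1; ext j; simp) h1
      simpa using this

end Freudenthal

namespace Freudenthal

/-- A generic odd labelling which is linear around the origin cannot have all of its zeros
away from the boundary of a finite symmetric region. -/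
theorem false_of_odd_labelling {m : ℕ} (D : Finset (Fin (m + 1) → ℤ)) (hD : ∀ x ∈ D, -x ∈ D)
    (w : (Fin (m + 1) → ℤ) → Fin m → ℝ) (hodd : ∀ x, w (-x) = -w x)
    (hstar : ∀ ρ k, vert (0, ρ) k ∈ D)
    (hw : ∀ ρ k, w (vert (0, ρ) k) = rampProj m (fun j => (vert (0, ρ) k j : ℝ)))
    (hgen : ∀ p, (∀ k, vert p k ∈ D ∧ vert p k ≠ 0) → GeneralPosition (fun k => w (vert p k)))
    (hbd : ∀ p, (∀ k, k ≠ 0 → vert p k ∈ D) → ZeroOnFacet (fun k => w (vert p k)) 0 →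
      p.1 ∈ D) : False := by
  classical
  let P : Finset ((Fin (m + 1) → ℤ) × Equiv.Perm (Fin (m + 2))) :=
    (D ×ˢ Finset.univ).filter fun p =>
      (∀ k, vert p k ∈ D ∧ vert p k ≠ 0) ∧ ZeroOnFacet (fun k => w (vert p k)) 0
  have hP : ∀ p, p ∈ P ↔
      (∀ k, vert p k ∈ D ∧ vert p k ≠ 0) ∧ ZeroOnFacet (fun k => w (vert p k)) 0 := by
    intro p
    simp only [P, Finset.mem_filter, Finset.mem_product, Finset.mem_univ, and_true]
    refine ⟨fun h => h.2, fun h => ⟨?_, h⟩⟩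
    simpa using (h.1 0).1
  -- the antipodal map
  have hα : ∀ p ∈ P, antipode p ∈ P := by
    intro p hp
    rw [hP] at hp ⊢
    refine ⟨fun k => ?_, by simpa using zeroOnFacet_antipode hodd hp.2⟩
    rw [vert_antipode]
    exact ⟨hD _ (hp.1 _).1, neg_ne_zero.2 (hp.1 _).2⟩
  have hanti : ∀ p ∈ P, ∀ k l, vert p k ≠ -vert p l := fun p hp k l h =>
    (((hP p).1 hp).1 k).2 (vert_eq_zero_of_eq_neg p h)
  have hα' : ∀ p ∈ P, antipode p ≠ p := by
    intro p hp h
    refine hanti p hp 0 0 ?_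
    have := vert_antipode p 0
    rwa [h, neg_zero] at this
  -- the other facet of the same simplex
  have huniq : ∀ p ∈ P, ∃! j, j ≠ 0 ∧ ZeroOnFacet (fun k => w (vert p k)) j := by
    intro p hp
    rw [hP] at hp
    exact (hgen p hp.1).existsUnique hp.2
  choose! r hr hr' using huniq
  have hβ : ∀ p ∈ P, rotate p (r p) ∈ P := by
    intro p hp
    have h := (hP p).1 hp
    rw [hP]
    refine ⟨fun k => ?_, ?_⟩
    · rw [vert_rotate]
      exact h.1 _
    · rw [zeroOnFacet_rotate_iff, zero_add]
      exact (hr p hp).2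
  have hrβ : ∀ p ∈ P, r (rotate p (r p)) = -r p := by
    intro p hp
    refine (hr' _ (hβ p hp) _ ⟨neg_ne_zero.2 (hr p hp).1, ?_⟩).symm
    rw [zeroOnFacet_rotate_iff, neg_add_cancel]
    exact ((hP p).1 hp).2
  have hrα : ∀ p ∈ P, r (antipode p) = -r p := by
    intro p hp
    exact (hr' _ (hα p hp) _
      ⟨neg_ne_zero.2 (hr p hp).1, zeroOnFacet_antipode hodd (hr p hp).2⟩).symm
  have h4 : 4 ∣ P.card := by
    refine four_dvd_card_of_involutions P antipode (fun p => rotate p (r p)) hα hβ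
      (fun p _ => antipode_antipode p) ?_ ?_ hα' ?_ ?_
    · intro p hp
      rw [hrβ p hp, rotate_rotate, neg_add_cancel, rotate_zero]
    · intro p hp
      rw [hrα p hp, antipode_rotate]
    · intro p hp h
      have h1 : vert p (r p) = vert p 0 := by
        rw [← zero_add (r p), ← vert_rotate, h]
      exact (hr p hp).1 (vert_injective p h1)
    · intro p hp h
      refine hanti p hp 0 (r p) ?_
      have := vert_antipode (rotate p (r p)) 0
      rwa [h, neg_zero, vert_rotate, zero_add] at this
  -- the simplices outside of the star of the origin
  let Q := P.filter fun p => (pivot p).1 ≠ 0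
  have h4' : 4 ∣ Q.card := by
    have hQ : ∀ p, p ∈ Q ↔ p ∈ P ∧ (pivot p).1 ≠ 0 := fun p => by simp [Q]
    refine four_dvd_card_of_involutions Q antipode pivot ?_ ?_
      (fun p _ => antipode_antipode p) (fun p _ => pivot_pivot p) (fun p _ => antipode_pivot p)
      ?_ ?_ ?_
    · intro p hp
      rw [hQ] at hp ⊢
      refine ⟨hα p hp.1, ?_⟩
      rw [← antipode_pivot]
      simpa [antipode] using hp.2
    · intro p hp
      rw [hQ] at hp ⊢
      have h := (hP p).1 hp.1
      have hz : ZeroOnFacet (fun k => w (vert (pivot p) k)) 0 := zeroOnFacet_pivot h.2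
      have hm : ∀ k, k ≠ 0 → vert (pivot p) k ∈ D := fun k hk => by
        rw [vert_pivot p hk]
        exact (h.1 k).1
      refine ⟨(hP _).2 ⟨fun k => ?_, hz⟩, ?_⟩
      · by_cases hk : k = 0
        · rw [hk, vert_zero]
          exact ⟨hbd _ hm hz, hp.2⟩
        · rw [vert_pivot p hk]
          exact h.1 k
      · rw [pivot_pivot, ← vert_zero]
        exact (h.1 0).2
    · exact fun p hp => hα' p ((hQ p).1 hp).1
    · exact fun p _ h => pivot_fst_ne p (congrArg Prod.fst h)
    · intro p hp h
      refine hanti p ((hQ p).1 hp).1 1 (-1) ?_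
      have := vert_antipode (pivot p) 1
      rwa [h, vert_pivot p (by simp)] at this
  -- the simplices adjacent to the star of the origin
  have hstar' : P.filter (fun p => ¬ (pivot p).1 ≠ 0) =
      {pivot (0, 1), pivot (0, Fin.revPerm)} := by
    ext p
    simp only [Finset.mem_filter, not_not, Finset.mem_insert, Finset.mem_singleton]
    constructor
    · rintro ⟨hp, h0⟩
      have hz := zeroOnFacet_pivot ((hP p).1 hp).2
      have h1 : pivot p = (0, (pivot p).2) := Prod.ext h0 rfl
      rw [h1] at hz
      simp only [hw] at hz
      rw [← pivot_pivot p]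
      rcases (zeroOnFacet_star_iff _).1 hz with h | h
      · left
        rw [h1, h]
      · right
        rw [h1, h]
    · have key : ∀ ρ : Equiv.Perm (Fin (m + 2)), ρ = 1 ∨ ρ = Fin.revPerm →
          pivot (0, ρ) ∈ P ∧ (pivot (pivot (0, ρ))).1 = 0 := by
        intro ρ hρ
        have hz : ZeroOnFacet (fun k => w (vert (0, ρ) k)) 0 := by
          simp only [hw]
          exact (zeroOnFacet_star_iff ρ).2 hρ
        have hz' := zeroOnFacet_pivot hz
        refine ⟨(hP _).2 ⟨fun k => ?_, hz'⟩, by rw [pivot_pivot]⟩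
        by_cases hk : k = 0
        · rw [hk, vert_zero]
          refine ⟨hbd _ (fun k hk => ?_) hz', pivot_fst_ne _⟩
          rw [vert_pivot _ hk]
          exact hstar _ _
        · rw [vert_pivot _ hk]
          refine ⟨hstar _ _, fun h => hk (vert_injective (0, ρ) ?_)⟩
          rw [h, vert_zero]
      rintro (rfl | rfl)
      · exact key 1 (Or.inl rfl)
      · exact key _ (Or.inr rfl)
  have hne : pivot ((0 : Fin (m + 1) → ℤ), (1 : Equiv.Perm (Fin (m + 2)))) ≠
      pivot (0, Fin.revPerm) := by
    intro h
    have h1 := congrArg (fun q => (pivot q).2 0) h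
    simp only [pivot_pivot] at h1
    simp [Fin.ext_iff] at h1
  have h5 := Finset.card_filter_add_card_filter_not (s := P) (fun p => (pivot p).1 ≠ 0)
  rw [hstar', Finset.card_pair hne] at h5
  change Q.card + 2 = P.card at h5
  omega

end Freudenthal

lemma coeff_eq_zero_of_chain {ι : Type*} {n : ℕ} (K : Finset ι) (S : ι → Finset (Fin n))
    (hchain : ∀ k ∈ K, ∀ l ∈ K, S k ⊆ S l ∨ S l ⊆ S k) (hinj : Set.InjOn S K)
    (hne : ∀ k ∈ K, (S k).Nonempty ∧ S k ≠ Finset.univ) (hcard : K.card + 2 ≤ n)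
    (c : ι → ℝ) (t s : ℝ)
    (h : ∀ i : Fin n, ∑ k ∈ K, (if i ∈ S k then c k else 0) = s + i * t) :
    ∀ k ∈ K, c k = 0 := by
  classical
  have ht : t = 0 := by
    obtain ⟨i, -, i', -, hii, hc⟩ := Finset.exists_ne_map_eq_of_card_lt_of_maps_to
      (s := (Finset.univ : Finset (Fin n))) (t := Finset.range (K.card + 1))
      (f := fun i => (K.filter (fun k => i ∈ S k)).card)
      (by simp; omega)
      (fun i _ => by
        simp only [Finset.coe_range, Set.mem_Iio]
        exact Nat.lt_succ_of_le (Finset.card_filter_le _ _))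
    have hsub : K.filter (fun k => i ∈ S k) ⊆ K.filter (fun k => i' ∈ S k) ∨
        K.filter (fun k => i' ∈ S k) ⊆ K.filter (fun k => i ∈ S k) := by
      by_contra! hcon
      obtain ⟨k, hk, hk'⟩ := Finset.not_subset.1 hcon.1
      obtain ⟨l, hl, hl'⟩ := Finset.not_subset.1 hcon.2
      simp only [Finset.mem_filter, not_and] at hk hk' hl hl'
      rcases hchain k hk.1 l hl.1 with h1 | h1
      · exact hl' hl.1 (h1 hk.2)
      · exact hk' hk.1 (h1 hl.2)
    have heq : K.filter (fun k => i ∈ S k) = K.filter (fun k => i' ∈ S k) := by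
      rcases hsub with h1 | h1
      · exact Finset.eq_of_subset_of_card_le h1 hc.ge
      · exact (Finset.eq_of_subset_of_card_le h1 hc.le).symm
    have h1 := h i
    have h2 := h i'
    rw [← Finset.sum_filter] at h1 h2
    rw [heq, h2] at h1
    have h3 : ((i' : ℝ) - i) * t = 0 := by linarith
    rcases mul_eq_zero.1 h3 with h4 | h4
    · exact absurd (Fin.ext (by exact_mod_cast (sub_eq_zero.1 h4).symm)) hii
    · exact h4
  subst ht
  simp only [mul_zero, add_zero] at h
  by_contra! hcon
  let T := K.filter (fun k => c k ≠ 0)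
  have hT : T.Nonempty := by
    obtain ⟨k, hk, hck⟩ := hcon
    exact ⟨k, by simp [T, hk, hck]⟩
  have hTK : ∀ k ∈ T, k ∈ K := fun k hk => (Finset.mem_filter.1 hk).1
  obtain ⟨k, hk, hmax⟩ := Finset.exists_max_image T (fun k => (S k).card) hT
  have hsub : ∀ l ∈ T, S l ⊆ S k := by
    intro l hl
    rcases hchain l (hTK l hl) k (hTK k hk) with h1 | h1
    · exact h1
    · exact (Finset.eq_of_subset_of_card_le h1 (hmax l hl)).ge
  obtain ⟨i, hi, hi'⟩ : ∃ i ∈ S k, ∀ l ∈ T.erase k, i ∉ S l := by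
    rcases (T.erase k).eq_empty_or_nonempty with h1 | h1
    · obtain ⟨i, hi⟩ := (hne k (hTK k hk)).1
      exact ⟨i, hi, by simp [h1]⟩
    · obtain ⟨l, hl, hlmax⟩ := Finset.exists_max_image _ (fun k => (S k).card) h1
      have hlT := Finset.mem_of_mem_erase hl
      have hnot : ¬ S k ⊆ S l := fun h2 => Finset.ne_of_mem_erase hl
        (hinj (hTK l hlT) (hTK k hk) ((hsub l hlT).antisymm h2))
      obtain ⟨i, hi, hi'⟩ := Finset.not_subset.1 hnot
      refine ⟨i, hi, fun l' hl' hil' => hi' ?_⟩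
      have hlT' := Finset.mem_of_mem_erase hl'
      rcases hchain l' (hTK l' hlT') l (hTK l hlT) with h2 | h2
      · exact h2 hil'
      · exact (Finset.eq_of_subset_of_card_le h2 (hlmax l' hl')).ge hil'
  obtain ⟨i', hi''⟩ : ∃ i', i' ∉ S k := by
    by_contra! hall
    exact (hne k (hTK k hk)).2 (Finset.eq_univ_of_forall hall)
  have h1 : ∑ l ∈ K, (if i ∈ S l then c l else 0) = c k := by
    rw [Finset.sum_eq_single_of_mem k (hTK k hk), if_pos hi]
    intro l hl hlk
    by_cases hcl : c l = 0
    · simp [hcl]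
    · rw [if_neg (hi' l (by simp [T, hl, hcl, hlk]))]
  have h2 : ∑ l ∈ K, (if i' ∈ S l then c l else 0) = 0 := by
    refine Finset.sum_eq_zero fun l hl => ?_
    by_cases hcl : c l = 0
    · simp [hcl]
    · rw [if_neg fun h3 => hi'' (hsub l (by simp [T, hl, hcl]) h3)]
  rw [h] at h1 h2
  exact (Finset.mem_filter.1 hk).2 (h1.symm.trans h2)

/-- A family of vectors can be perturbed, away from a finite set `L` of indices, so that it has
no linear dependencies of length at most the dimension except those coming from `L`. -/
lemma exists_generic_perturbation {α : Type*} {m : ℕ} (L : Finset α) (v : α → Fin m → ℝ)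
    {ε : ℝ} (hε : 0 < ε) (F : Finset α) :
    ∃ u : α → Fin m → ℝ, (∀ x ∈ L, u x = v x) ∧ (∀ x, ‖u x - v x‖ < ε) ∧
      ∀ B : Finset α, (∀ x ∈ B, x ∈ F ∨ x ∈ L) → B.card ≤ m →
        LinearIndepOn ℝ u {x | x ∈ B ∧ x ∈ L} → LinearIndepOn ℝ u (B : Set α) := by
  classical
  induction F using Finset.induction_on with
  | empty =>
    refine ⟨v, fun _ _ => rfl, fun x => by simpa using hε, fun B hB _ h => ?_⟩
    refine h.mono fun x hx => ⟨hx, ?_⟩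
    simpa using hB x hx
  | insert a F haF ih =>
    obtain ⟨u, huL, huv, hu⟩ := ih
    by_cases haL : a ∈ L
    · refine ⟨u, huL, huv, fun B hB => hu B fun x hx => ?_⟩
      rcases hB x hx with h | h
      · rcases Finset.mem_insert.1 h with rfl | h
        · exact Or.inr haL
        · exact Or.inl h
      · exact Or.inr h
    let 𝒮 : Finset (Finset α) := (F ∪ L).powerset.filter fun B => B.card < m
    have hdense : Dense (⋂ B ∈ (𝒮 : Set (Finset α)),
        ((Submodule.span ℝ (u '' (B : Set α)) : Set (Fin m → ℝ)))ᶜ) := by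
      refine dense_biInter_of_isOpen (fun B _ => ?_) 𝒮.countable_toSet fun B hB => ?_
      · exact (Submodule.closed_of_finiteDimensional _).isOpen_compl
      · rw [← interior_eq_empty_iff_dense_compl]
        by_contra hne
        have htop := Submodule.eq_top_of_nonempty_interior' _
          (Set.nonempty_iff_ne_empty.2 hne)
        have h1 : Module.finrank ℝ (Submodule.span ℝ (u '' (B : Set α))) ≤ B.card := by
          rw [← Finset.coe_image]
          exact (finrank_span_finset_le_card _).trans Finset.card_image_le
        rw [htop, finrank_top, Module.finrank_fin_fun] at h1
        have h2 : B ∈ 𝒮 := hB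
        simp only [𝒮, Finset.mem_filter] at h2
        omega
    obtain ⟨z, hz, hzv⟩ := hdense.exists_dist_lt (v a) hε
    have hz' : ∀ B ∈ 𝒮, z ∉ Submodule.span ℝ (u '' (B : Set α)) := by
      intro B hB
      exact Set.mem_iInter₂.1 hz B hB
    have hupd : ∀ s : Set α, a ∉ s → Set.EqOn u (Function.update u a z) s := by
      intro s has x hx
      rw [Function.update_of_ne]
      rintro rfl
      exact has hx
    refine ⟨Function.update u a z, fun x hx => ?_, fun x => ?_, fun B hB hcard hBL => ?_⟩
    · rw [← huL x hx, Function.update_of_ne]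
      rintro rfl
      exact haL hx
    · by_cases hx : x = a
      · subst hx
        rwa [Function.update_self, ← dist_eq_norm, dist_comm]
      · rw [Function.update_of_ne hx]
        exact huv x
    · have hBL' : LinearIndepOn ℝ u {x | x ∈ B ∧ x ∈ L} :=
        (linearIndepOn_congr (hupd _ fun h => haL h.2)).2 hBL
      by_cases haB : a ∈ B
      · have h1 : LinearIndepOn ℝ u ((B.erase a : Finset α) : Set α) := by
          refine hu _ (fun x hx => ?_) ((Finset.card_erase_le).trans hcard) (hBL'.mono ?_)
          · obtain ⟨hxa, hxB⟩ := Finset.mem_erase.1 hx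
            have := hB x hxB
            simpa [hxa] using this
          · exact fun x hx => ⟨Finset.mem_of_mem_erase hx.1, hx.2⟩
        have ha' : a ∉ ((B.erase a : Finset α) : Set α) := by simp
        rw [← Finset.insert_erase haB, Finset.coe_insert, linearIndepOn_insert ha',
          ← linearIndepOn_congr (hupd _ ha'), ← Set.EqOn.image_eq (hupd _ ha'),
          Function.update_self]
        refine ⟨h1, hz' _ ?_⟩
        simp only [𝒮, Finset.mem_filter, Finset.mem_powerset]
        refine ⟨fun x hx => ?_, ?_⟩
        · obtain ⟨hxa, hxB⟩ := Finset.mem_erase.1 hx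
          have := hB x hxB
          simpa [hxa] using this
        · rw [Finset.card_erase_of_mem haB]
          have := Finset.card_pos.2 ⟨a, haB⟩
          omega
      · rw [← linearIndepOn_congr (hupd _ (by simpa using haB))]
        refine hu B (fun x hx => ?_) hcard hBL'
        have hxa : x ≠ a := by
          rintro rfl
          exact haB hx
        have := hB x hx
        simpa [hxa] using this

namespace Freudenthal

/-- The lattice points of the star of the origin in the Freudenthal triangulation. -/
def IsStar {m : ℕ} (x : Fin (m + 1) → ℤ) : Prop :=
  ∃ S : Finset (Fin (m + 2)), ∀ j, x j = (if j.succ ∈ S then 1 else 0) - (if 0 ∈ S then 1 else 0)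

lemma isStar_zero {m : ℕ} : IsStar (0 : Fin (m + 1) → ℤ) := ⟨∅, fun j => by simp⟩

lemma IsStar.neg {m : ℕ} {x : Fin (m + 1) → ℤ} (hx : IsStar x) : IsStar (-x) := by
  obtain ⟨S, hS⟩ := hx
  refine ⟨Sᶜ, fun j => ?_⟩
  rw [Pi.neg_apply, hS]
  simp only [Finset.mem_compl]
  split_ifs <;> simp_all

lemma isStar_vert {m : ℕ} (ρ : Equiv.Perm (Fin (m + 2))) (k : Fin (m + 2)) :
    IsStar (vert (0, ρ) k) :=
  ⟨Finset.univ.filter fun i => ρ i < k, fun j => by simp [vert]⟩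

lemma IsStar.abs_le {m : ℕ} {x : Fin (m + 1) → ℤ} (hx : IsStar x) (j : Fin (m + 1)) :
    |x j| ≤ 1 := by
  obtain ⟨S, hS⟩ := hx
  rw [hS]
  split_ifs <;> simp

/-- At most `m` nonzero vertices of a simplex that lie in the star of the origin have linearly
independent images under `rampProj`. -/
lemma coeff_eq_zero_of_isStar {m : ℕ} (p : (Fin (m + 1) → ℤ) × Equiv.Perm (Fin (m + 2)))
    (K : Finset (Fin (m + 2))) (hcard : K.card ≤ m)
    (hK : ∀ k ∈ K, IsStar (vert p k) ∧ vert p k ≠ 0) (c : Fin (m + 2) → ℝ)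
    (h : ∑ k ∈ K, c k • rampProj m (fun j => (vert p k j : ℝ)) = 0) : ∀ k ∈ K, c k = 0 := by
  classical
  choose! S hS using fun k hk => (hK k hk).1
  have hne : ∀ k ∈ K, (S k).Nonempty ∧ S k ≠ Finset.univ := by
    intro k hk
    refine ⟨?_, ?_⟩
    · by_contra h0
      rw [Finset.not_nonempty_iff_eq_empty] at h0
      exact (hK k hk).2 (funext fun j => by simp [hS k hk j, h0])
    · intro h0
      exact (hK k hk).2 (funext fun j => by simp [hS k hk j, h0])
  have hinj : Set.InjOn S K := by
    intro k hk l hl hkl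
    exact vert_injective p (funext fun j => by rw [hS k hk j, hS l hl j, hkl])
  -- indicator of a vertex set, relative to the element `0`
  have hind : ∀ k ∈ K, ∀ l ∈ K, ∀ i,
      ((if i ∈ S k then 1 else 0) - (if 0 ∈ S k then 1 else 0) : ℤ)
        - ((if i ∈ S l then 1 else 0) - (if 0 ∈ S l then 1 else 0))
      = ((if p.2 i < k then 1 else 0) - (if p.2 0 < k then 1 else 0))
        - ((if p.2 i < l then 1 else 0) - (if p.2 0 < l then 1 else 0)) := by
    intro k hk l hl i
    refine Fin.cases (by simp) (fun j => ?_) i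
    rw [← hS k hk j, ← hS l hl j]
    simp only [vert]
    ring
  have hchain' : ∀ k ∈ K, ∀ l ∈ K, k ≤ l → S k ⊆ S l ∨ S l ⊆ S k := by
    intro k hk l hl hkl
    by_contra hcon
    rw [not_or, Finset.not_subset, Finset.not_subset] at hcon
    obtain ⟨⟨a, hak, hal⟩, ⟨b, hbl, hbk⟩⟩ := hcon
    have h1 := hind k hk l hl a
    have h2 := hind k hk l hl b
    have h3 : p.2 a < k → p.2 a < l := fun h => h.trans_le hkl
    have h4 : p.2 b < k → p.2 b < l := fun h => h.trans_le hkl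
    simp only [hak, hal, hbl, hbk, if_true, if_false] at h1 h2
    split_ifs at h1 h2 <;> omega
  have hchain : ∀ k ∈ K, ∀ l ∈ K, S k ⊆ S l ∨ S l ⊆ S k := by
    intro k hk l hl
    rcases le_total k l with hkl | hkl
    · exact hchain' k hk l hl hkl
    · exact (hchain' l hl k hk hkl).symm
  rw [← Finset.sum_congr rfl fun k _ => map_smul (rampProj m) (c k) _, ← map_sum,
    rampProj_eq_zero_iff] at h
  obtain ⟨t, ht⟩ := h
  refine coeff_eq_zero_of_chain K S hchain hinj hne (by omega) c t
    (∑ k ∈ K, if 0 ∈ S k then c k else 0) fun i => ?_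
  refine Fin.cases (by simp) (fun j => ?_) i
  have h1 := ht j
  rw [Finset.sum_apply] at h1
  have h2 : ∑ k ∈ K, (c k • fun j => ((vert p k j : ℤ) : ℝ)) j
      = ∑ k ∈ K, ((if j.succ ∈ S k then c k else 0) - (if 0 ∈ S k then c k else 0)) := by
    refine Finset.sum_congr rfl fun k hk => ?_
    rw [Pi.smul_apply, hS k hk j, smul_eq_mul]
    split_ifs <;> simp
  rw [h2, Finset.sum_sub_distrib] at h1
  rw [Fin.val_succ]
  push_cast
  linarith

end Freudenthal

namespace Freudenthal

/-- An odd labelling which is linear on the star of the origin can be perturbed, away from that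
star, to an odd labelling in general position. -/
lemma exists_odd_generic {m : ℕ} (D : Finset (Fin (m + 1) → ℤ)) (hD : ∀ x ∈ D, -x ∈ D)
    (hD0 : 0 ∈ D) (w₀ : (Fin (m + 1) → ℤ) → Fin m → ℝ) (hodd : ∀ x, w₀ (-x) = -w₀ x)
    (hstar : ∀ x, IsStar x → w₀ x = rampProj m (fun j => (x j : ℝ))) {ε : ℝ} (hε : 0 < ε) :
    ∃ w : (Fin (m + 1) → ℤ) → Fin m → ℝ, (∀ x, w (-x) = -w x) ∧
      (∀ x ∈ D, IsStar x → w x = w₀ x) ∧ (∀ x, ‖w x - w₀ x‖ < ε) ∧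
      ∀ p, (∀ k, vert p k ∈ D ∧ vert p k ≠ 0) → GeneralPosition (fun k => w (vert p k)) := by
  classical
  let rep : (Fin (m + 1) → ℤ) → (Fin (m + 1) → ℤ) := fun x =>
    Classical.epsilon fun y => y = x ∨ y = -x
  let s : (Fin (m + 1) → ℤ) → ℝ := fun x => if rep x = x then 1 else -1
  have hrep : ∀ x, rep x = x ∨ rep x = -x := fun x =>
    Classical.epsilon_spec (p := fun y => y = x ∨ y = -x) ⟨x, Or.inl rfl⟩
  have hrep_neg : ∀ x, rep (-x) = rep x := by
    intro x
    simp only [rep, neg_neg, or_comm]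
  have hrepD : ∀ x ∈ D, rep x ∈ D := by
    intro x hx
    rcases hrep x with h | h <;> rw [h]
    exacts [hx, hD x hx]
  have hrepS : ∀ x, IsStar (rep x) → IsStar x := by
    intro x hx
    rcases hrep x with h | h <;> rw [h] at hx
    exacts [hx, by simpa using hx.neg]
  have hrepS' : ∀ x, IsStar x → IsStar (rep x) := by
    intro x hx
    rcases hrep x with h | h <;> rw [h]
    exacts [hx, hx.neg]
  have hrep0 : rep 0 = 0 := by simpa using hrep 0
  have hss : ∀ x, s x * s x = 1 := by
    intro x
    simp only [s]
    split_ifs <;> norm_num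
  have hs0 : ∀ x, s x ≠ 0 := fun x h => by simpa [h] using hss x
  have hsnorm : ∀ x, ‖s x‖ = 1 := by
    intro x
    simp only [s]
    split_ifs <;> simp
  have hs_neg : ∀ x, x ≠ 0 → s (-x) = -s x := by
    intro x hx
    have hne : x ≠ -x := fun h => hx (self_eq_neg.1 h)
    simp only [s, hrep_neg]
    rcases hrep x with h | h
    · rw [h, if_neg hne, if_pos rfl]
    · rw [h, if_pos rfl, if_neg hne.symm, neg_neg]
  have hw₀rep : ∀ x, w₀ x = s x • w₀ (rep x) := by
    intro x
    simp only [s]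
    split_ifs with h
    · rw [h, one_smul]
    · rw [(hrep x).resolve_left h, hodd, neg_smul, one_smul, neg_neg]
  have hw₀0 : w₀ 0 = 0 := by
    have := hodd 0
    rw [neg_zero] at this
    exact self_eq_neg.1 this
  obtain ⟨u, huL, huv, hu⟩ := exists_generic_perturbation (D.filter IsStar) w₀ hε D
  have huL' : ∀ x ∈ D, IsStar x → u x = w₀ x := fun x hx hxs =>
    huL x (Finset.mem_filter.2 ⟨hx, hxs⟩)
  refine ⟨fun x => s x • u (rep x), fun x => ?_, fun x hx hxs => ?_, fun x => ?_, fun p hp => ?_⟩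
  · by_cases hx : x = 0
    · subst hx
      have : u 0 = 0 := by rw [huL' 0 hD0 isStar_zero, hw₀0]
      simp [hrep0, this]
    · simp only [hrep_neg, hs_neg x hx, neg_smul]
  · simp only
    rw [huL' _ (hrepD x hx) (hrepS' x hxs), ← hw₀rep]
  · rw [hw₀rep x, ← smul_sub, norm_smul, hsnorm, one_mul]
    exact huv _
  · have hinj : Function.Injective fun k => rep (vert p k) := by
      intro k l hkl
      have hkl' : rep (vert p k) = rep (vert p l) := hkl
      by_contra hne
      have hne' : vert p k ≠ vert p l := fun h => hne (vert_injective p h)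
      have h0 : vert p k ≠ -vert p l := fun h => (hp k).2 (vert_eq_zero_of_eq_neg p h)
      rcases hrep (vert p k) with h1 | h1 <;> rcases hrep (vert p l) with h2 | h2 <;>
        rw [h1, h2] at hkl'
      · exact hne' hkl'
      · exact h0 hkl'
      · exact h0 (neg_eq_iff_eq_neg.1 hkl')
      · exact hne' (neg_injective hkl')
    intro c hc i j hij hci hcj
    let K : Finset (Fin (m + 2)) := (Finset.univ.erase i).erase j
    have hKcard : K.card = m := by
      rw [Finset.card_erase_of_mem (Finset.mem_erase.2 ⟨hij.symm, Finset.mem_univ _⟩),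
        Finset.card_erase_of_mem (Finset.mem_univ _)]
      simp
    have hstarLI : LinearIndepOn ℝ u
        {x | x ∈ K.image (fun k => rep (vert p k)) ∧ x ∈ D.filter IsStar} := by
      let K' := K.filter fun k => IsStar (vert p k)
      have h1 : LinearIndepOn ℝ (u ∘ fun k => rep (vert p k)) (K' : Set (Fin (m + 2))) := by
        rw [linearIndepOn_finset_iff]
        intro f hf k hk
        have h2 := coeff_eq_zero_of_isStar p K' ((Finset.card_filter_le _ _).trans hKcard.le)
          (fun k hk => ⟨(Finset.mem_filter.1 hk).2, (hp k).2⟩)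
          (fun k => f k * s (vert p k)) ?_ k hk
        · exact (mul_eq_zero.1 h2).resolve_right (hs0 _)
        · rw [← hf]
          refine Finset.sum_congr rfl fun k hk => ?_
          have hks := (Finset.mem_filter.1 hk).2
          rw [Function.comp_apply, huL' _ (hrepD _ (hp k).1) (hrepS' _ hks), ← hstar _ hks,
            hw₀rep (vert p k), smul_smul, mul_assoc, hss, mul_one]
      refine (h1.image_of_comp _ _).mono ?_
      rintro x ⟨hx1, hx2⟩
      obtain ⟨k, hk, rfl⟩ := Finset.mem_image.1 hx1
      exact ⟨k, Finset.mem_filter.2 ⟨hk, hrepS _ (Finset.mem_filter.1 hx2).2⟩, rfl⟩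
    have hLI := hu (K.image fun k => rep (vert p k)) (fun x hx => ?_)
      (Finset.card_image_le.trans hKcard.le) hstarLI
    · rw [Finset.coe_image] at hLI
      have h1 := linearIndepOn_finset_iff.1 (hLI.comp_of_image hinj.injOn)
        (fun k => c k * s (vert p k)) ?_
      · funext k
        by_cases hki : k = i
        · rw [hki, hci]
          rfl
        by_cases hkj : k = j
        · rw [hkj, hcj]
          rfl
        exact (mul_eq_zero.1 (h1 k (by simp [K, hki, hkj]))).resolve_right (hs0 _)
      · rw [← hc]
        refine Finset.sum_subset_zero_on_sdiff (Finset.subset_univ _) (fun k hk => ?_)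
          fun k _ => ?_
        · have : k = j ∨ k = i := by
            by_contra h
            rw [not_or] at h
            simp [K, h.1, h.2] at hk
          rcases this with rfl | rfl
          · rw [hcj, zero_smul]
          · rw [hci, zero_smul]
        · rw [Function.comp_apply, smul_smul]
    · obtain ⟨k, -, rfl⟩ := Finset.mem_image.1 hx
      exact Or.inl (hrepD _ (hp k).1)

end Freudenthal

lemma IsPreconnected.inter_frontier_nonempty_of_isOpen {α : Type*} [TopologicalSpace α]
    {s u : Set α} (hs : IsPreconnected s) (hu : IsOpen u) (h : (s ∩ u).Nonempty)
    (h' : (s ∩ uᶜ).Nonempty) : (s ∩ frontier u).Nonempty := by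
  by_contra hne
  have hsub : ∀ x ∈ s, x ∈ closure u → x ∈ u := by
    intro x hx hxu
    by_contra hxu'
    exact hne ⟨x, hx, hxu, fun hi => hxu' (interior_subset hi)⟩
  obtain ⟨x, hx, hxu⟩ := h'
  obtain ⟨y, -, hyu, hyu'⟩ := hs u (closure u)ᶜ hu isClosed_closure.isOpen_compl
    (fun y hy => or_iff_not_imp_right.2 fun hy' => hsub y hy (not_not.1 hy')) h
    ⟨x, hx, fun hx' => hxu (hsub x hx hx')⟩
  exact hyu' (subset_closure hyu)

namespace Freudenthal

/-- **Borsuk's theorem** (boundary form): an odd map into a space of smaller dimension has a zero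
on the boundary of every bounded symmetric open neighbourhood of the origin. -/
theorem exists_mem_frontier_eq_zero {m : ℕ} {f : (Fin (m + 1) → ℝ) → Fin m → ℝ}
    (hf : Continuous f) (hodd : ∀ x, f (-x) = -f x) {U : Set (Fin (m + 1) → ℝ)} (hU : IsOpen U)
    (hUb : Bornology.IsBounded U) (hsymm : ∀ x ∈ U, -x ∈ U) (h0 : 0 ∈ U) :
    ∃ y ∈ frontier U, f y = 0 := by
  classical
  by_contra! hne
  have hK : IsCompact (frontier U) :=
    Metric.isCompact_of_isClosed_isBounded isClosed_frontier
      (hUb.closure.subset frontier_subset_closure)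
  obtain ⟨δ, hδ, hfδ⟩ : ∃ δ > 0, ∀ z ∈ frontier U, δ ≤ ‖f z‖ := by
    rcases (frontier U).eq_empty_or_nonempty with h | h
    · exact ⟨1, one_pos, by simp [h]⟩
    · obtain ⟨z, hz, hmin⟩ := hK.exists_isMinOn h hf.norm.continuousOn
      exact ⟨‖f z‖, norm_pos_iff.2 (hne z hz), fun y hy => hmin hy⟩
  obtain ⟨η, hη, hfη⟩ : ∃ η > 0, ∀ z ∈ frontier U, ∀ y, dist z y < η →
      dist (f z) (f y) < δ / 2 := by
    have h := hK.uniformContinuousAt_of_continuousAt f (fun x _ => hf.continuousAt)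
      (Metric.dist_mem_uniformity (half_pos hδ))
    obtain ⟨η, hη, h⟩ := Metric.mem_uniformity_dist.1 h
    exact ⟨η, hη, fun z hz y hy => h hy hz⟩
  obtain ⟨r, hr, hrU⟩ := Metric.isOpen_iff.1 hU 0 h0
  obtain ⟨h, hh, hhr, hhη⟩ : ∃ h : ℝ, 0 < h ∧ 3 * h < r ∧ 4 * h < η := by
    have h1 := min_le_left r η
    have h2 := min_le_right r η
    have h3 := lt_min hr hη
    exact ⟨min r η / 5, by positivity, by linarith, by linarith⟩
  let pt : (Fin (m + 1) → ℤ) → Fin (m + 1) → ℝ := fun x j => h * x j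
  have hpt_neg : ∀ x, pt (-x) = -pt x := fun x => by
    funext j
    simp [pt]
  have hfin : {x | pt x ∈ U}.Finite := by
    obtain ⟨C, hC⟩ := hUb.exists_norm_le
    refine (Set.finite_Icc (fun _ => -⌈C / h⌉ : Fin (m + 1) → ℤ) fun _ => ⌈C / h⌉).subset ?_
    intro x hx
    have h1 : ∀ j, |x j| ≤ ⌈C / h⌉ := by
      intro j
      have h2 := (norm_le_pi_norm (pt x) j).trans (hC _ hx)
      rw [Real.norm_eq_abs, abs_mul, abs_of_pos hh, mul_comm, ← le_div_iff₀ hh] at h2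
      have h3 : ((|x j| : ℤ) : ℝ) ≤ ⌈C / h⌉ := by
        rw [Int.cast_abs]
        exact h2.trans (Int.le_ceil _)
      exact_mod_cast h3
    exact ⟨fun j => (abs_le.1 (h1 j)).1, fun j => (abs_le.1 (h1 j)).2⟩
  let D : Finset (Fin (m + 1) → ℤ) := hfin.toFinset
  have hD : ∀ x, x ∈ D ↔ pt x ∈ U := fun x => by simp [D]
  have hDneg : ∀ x ∈ D, -x ∈ D := by
    intro x hx
    rw [hD] at hx ⊢
    rw [hpt_neg]
    exact hsymm _ hx
  have hsmall : ∀ x, ‖pt x‖ ≤ 3 * h → x ∈ D := by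
    intro x hx
    rw [hD]
    exact hrU (mem_ball_zero_iff.2 (hx.trans_lt hhr))
  have hstar_norm : ∀ x, IsStar x → ‖pt x‖ ≤ h := by
    intro x hx
    rw [pi_norm_le_iff_of_nonneg hh.le]
    intro j
    have h1 : |(x j : ℝ)| ≤ 1 := by exact_mod_cast hx.abs_le j
    rw [Real.norm_eq_abs, abs_mul, abs_of_pos hh]
    nlinarith
  have hstarD : ∀ x, IsStar x → x ∈ D := fun x hx => hsmall x (by linarith [hstar_norm x hx])
  have hdist : ∀ p k l, dist (pt (vert p k)) (pt (vert p l)) ≤ 2 * h := by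
    intro p k l
    rw [dist_pi_le_iff (by positivity)]
    intro j
    have h1 : |(vert p k j : ℝ) - vert p l j| ≤ 2 := by exact_mod_cast abs_vert_sub_le p k l j
    rw [Real.dist_eq, ← mul_sub, abs_mul, abs_of_pos hh]
    nlinarith
  let w₀ : (Fin (m + 1) → ℤ) → Fin m → ℝ := fun x =>
    if IsStar x then rampProj m (fun j => (x j : ℝ)) else f (pt x)
  have hw₀odd : ∀ x, w₀ (-x) = -w₀ x := by
    intro x
    by_cases hx : IsStar x
    · simp only [w₀, if_pos hx, if_pos hx.neg]
      rw [← map_neg]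
      congr 1
      funext j
      simp
    · have hx' : ¬ IsStar (-x) := fun h => hx (by simpa using h.neg)
      simp only [w₀, if_neg hx, if_neg hx', hpt_neg, hodd]
  have hw₀star : ∀ x, IsStar x → w₀ x = rampProj m (fun j => (x j : ℝ)) := fun x hx => if_pos hx
  obtain ⟨w, hwodd, hwstar, hww₀, hwgen⟩ := exists_odd_generic D hDneg (hstarD 0 isStar_zero) w₀
    hw₀odd hw₀star (half_pos hδ)
  refine false_of_odd_labelling D hDneg w hwodd (fun ρ k => hstarD _ (isStar_vert ρ k))
    (fun ρ k => ?_) hwgen fun p hp hzero => ?_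
  · rw [hwstar _ (hstarD _ (isStar_vert ρ k)) (isStar_vert ρ k), hw₀star _ (isStar_vert ρ k)]
  · by_contra hpD
    have hnstar : ∀ k, k ≠ 0 → ¬ IsStar (vert p k) := by
      intro k hk hks
      refine hpD (hsmall _ ?_)
      have h1 := hdist p 0 k
      rw [vert_zero, dist_eq_norm] at h1
      have h2 := norm_sub_norm_le (pt p.1) (pt (vert p k))
      linarith [hstar_norm _ hks]
    have hl : Fin.last (m + 1) ≠ 0 := by simp [Fin.ext_iff]
    obtain ⟨z, hzseg, hzU⟩ : (segment ℝ (pt (vert p (Fin.last _))) (pt p.1) ∩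
        frontier U).Nonempty := by
      exact (convex_segment _ _).isPreconnected.inter_frontier_nonempty_of_isOpen hU
        ⟨_, left_mem_segment _ _ _, (hD _).1 (hp _ hl)⟩
        ⟨_, right_mem_segment _ _ _, fun h => hpD ((hD _).2 h)⟩
    have hz : ∀ k, dist z (pt (vert p k)) < η := by
      intro k
      have hsub : segment ℝ (pt (vert p (Fin.last _))) (pt p.1) ⊆
          Metric.closedBall (pt (vert p k)) (2 * h) :=
        (convex_closedBall _ _).segment_subset (hdist p _ k) (by simpa using hdist p 0 k)
      have := Metric.mem_closedBall.1 (hsub hzseg)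
      linarith
    have hwz : ∀ k, k ≠ 0 → w (vert p k) ∈ Metric.ball (f z) δ := by
      intro k hk
      have h1 := hfη z hzU _ (hz k)
      have h2 := hww₀ (vert p k)
      rw [show w₀ (vert p k) = f (pt (vert p k)) from if_neg (hnstar k hk), ← dist_eq_norm] at h2
      rw [Metric.mem_ball]
      have h3 := dist_triangle_right (w (vert p k)) (f z) (f (pt (vert p k)))
      linarith
    obtain ⟨c, hc, hc0, hc1, hcs⟩ := hzero
    have h1 := (convex_ball (f z) δ).sum_mem (t := Finset.univ.erase 0) (w := c)
      (z := fun k => w (vert p k)) (fun k _ => hc k) ?_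
      (fun k hk => hwz k (Finset.ne_of_mem_erase hk))
    · rw [Finset.sum_erase _ (by simp [hc0]), hcs, mem_ball_iff_norm, zero_sub, norm_neg] at h1
      exact absurd h1 (not_lt.2 (hfδ z hzU))
    · rw [Finset.sum_erase _ hc0, hc1]

end Freudenthal

lemma exists_injective_continuousLinearMap_fin_of_le_finrank {X : Type*} [NormedAddCommGroup X]
    [NormedSpace ℝ X] (V : Submodule ℝ X) [FiniteDimensional ℝ V] {n : ℕ}
    (hn : n ≤ Module.finrank ℝ V) :
    ∃ Φ : (Fin n → ℝ) →L[ℝ] X, Function.Injective Φ ∧ ∀ y, Φ y ∈ V := by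
  let b := Module.finBasis ℝ V
  have hli : LinearIndependent ℝ fun j : Fin n => b (Fin.castLE hn j) :=
    b.linearIndependent.comp _ (Fin.castLE_injective hn)
  refine ⟨LinearMap.toContinuousLinearMap
    (V.subtype ∘ₗ Fintype.linearCombination ℝ fun j : Fin n => b (Fin.castLE hn j)), ?_, ?_⟩
  · exact V.injective_subtype.comp (linearIndependent_iff_injective_fintypeLinearCombination.1 hli)
  · exact fun y => Subtype.prop _

lemma ContinuousLinearMap.exists_norm_le_mul_norm_of_injective {E F : Type*}
    [NormedAddCommGroup E] [NormedSpace ℝ E] [FiniteDimensional ℝ E] [NormedAddCommGroup F]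
    [NormedSpace ℝ F] (f : E →L[ℝ] F) (hf : Function.Injective f) :
    ∃ C : ℝ, 0 ≤ C ∧ ∀ x, ‖x‖ ≤ C * ‖f x‖ := by
  obtain ⟨K, -, hK⟩ := LinearMap.exists_antilipschitzWith (f : E →ₗ[ℝ] F)
    (LinearMap.ker_eq_bot.2 hf)
  exact ⟨K, K.2, fun x => hK.le_mul_norm (map_zero f) x⟩

/-- **Intersection Lemma.**  If `V`, `Z`, `M` are closed subsets of `X` such that `V`, `Z`
are subspaces with `V + Z = X` and `codim Z < dim V < +∞`, and `M` is the boundary of a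
symmetric neighborhood of the origin which is bounded in the `W`-norm, then for every odd
homeomorphism `γ : X → X` fixing the points of `V` with `‖u‖_X ≥ R` one has
`γ(V) ∩ M ∩ Z ≠ ∅`. -/
theorem intersection_lemma
    (ι : X →L[ℝ] W) (hι : Function.Injective ι) (σ₀ : ℝ) (hσ₀ : 0 < σ₀)
    (hemb : ∀ u : X, ‖ι u‖ ≤ σ₀ * ‖u‖)
    (V Z : Submodule ℝ X) (hVcl : IsClosed (V : Set X)) (hZcl : IsClosed (Z : Set X))
    (hVZ : V ⊔ Z = ⊤)
    (hVfin : FiniteDimensional ℝ V) (hZcofin : FiniteDimensional ℝ (X ⧸ Z))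
    (hdim : Module.finrank ℝ (X ⧸ Z) < Module.finrank ℝ V)
    (Nset : Set X) (hNnbhd : Nset ∈ 𝓝 (0 : X)) (hNsymm : ∀ u ∈ Nset, -u ∈ Nset)
    (hNbdd : ∃ C : ℝ, ∀ u ∈ Nset, ‖ι u‖ ≤ C)
    (M : Set X) (hM : M = frontier Nset) (hMcl : IsClosed M)
    (R : ℝ) (hR : 0 < R)
    (γ : X ≃ₜ X) (hγodd : ∀ v : X, γ (-v) = -γ v)
    (hγfix : ∀ v ∈ V, R ≤ ‖v‖ → γ v = v) :
    ((fun v => γ v) '' (V : Set X) ∩ M ∩ Z).Nonempty := by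
  have := hZcl
  obtain ⟨Φ, hΦ, hΦV⟩ :=
    exists_injective_continuousLinearMap_fin_of_le_finrank V (Nat.succ_le_of_lt hdim)
  obtain ⟨A, hA, hΦA⟩ := Φ.exists_norm_le_mul_norm_of_injective hΦ
  obtain ⟨B, hB, hΦB⟩ := (ι.comp Φ).exists_norm_le_mul_norm_of_injective (hι.comp hΦ)
  obtain ⟨C, hC⟩ := hNbdd
  let ψ : (X ⧸ Z) ≃L[ℝ] (Fin (Module.finrank ℝ (X ⧸ Z)) → ℝ) :=
    ContinuousLinearEquiv.ofFinrankEq (by simp)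
  have : IsAddTorsionFree X := .of_isTorsionFree ℝ X
  have hγ0 : γ 0 = 0 := by
    have := hγodd 0
    rw [neg_zero] at this
    exact self_eq_neg.1 this
  have hcont : Continuous fun y => γ (Φ y) := γ.continuous.comp Φ.continuous
  have hbdd : ∀ y, γ (Φ y) ∈ interior Nset → ‖y‖ ≤ max (A * R) (B * C) := by
    intro y hy
    by_cases hyR : R ≤ ‖Φ y‖
    · rw [hγfix _ (hΦV y) hyR] at hy
      exact le_max_of_le_right
        ((hΦB y).trans (mul_le_mul_of_nonneg_left (hC _ (interior_subset hy)) hB))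
    · exact le_max_of_le_left
        ((hΦA y).trans (mul_le_mul_of_nonneg_left (not_le.1 hyR).le hA))
  have hint : ∀ u ∈ interior Nset, -u ∈ interior Nset := by
    intro u hu
    have hsub : (Homeomorph.neg X) ⁻¹' interior Nset ⊆ Nset := fun v hv => by
      simpa using hNsymm _ (interior_subset hv)
    refine interior_maximal hsub (isOpen_interior.preimage (Homeomorph.neg X).continuous) ?_
    simpa using hu
  obtain ⟨y, hyU, hy⟩ := Freudenthal.exists_mem_frontier_eq_zero
    (f := fun y => ψ (Z.mkQ (γ (Φ y))))
    (U := {y | γ (Φ y) ∈ interior Nset})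
    (ψ.continuous.comp (Z.mkQL.continuous.comp hcont))
    (fun y => by simp only [map_neg, hγodd])
    (isOpen_interior.preimage hcont)
    (isBounded_iff_forall_norm_le.2 ⟨_, hbdd⟩)
    (fun y hy => by simpa only [Set.mem_ofPred_eq, map_neg, hγodd] using hint _ hy)
    (by simpa [hγ0] using mem_interior_iff_mem_nhds.2 hNnbhd)
  refine ⟨γ (Φ y), ⟨⟨Φ y, hΦV y, rfl⟩, ?_⟩, ?_⟩
  · have hyU' := hcont.frontier_preimage_subset _ hyU
    rw [hM]
    exact frontier_interior_subset hyU'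
  · simpa using hy
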